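/- arXiv:1005.0829 — 6 statements merged into one kernel-verified Lean document; each statement's English description precedes it below -/
import Mathlib

section
/- Let p, q, n ≥ 1 be integers, σ > 0, κ > 0, η ∈ (0,1), and set λ = 2κσ√(2n·log(p/η)). Let A be a q×p real matrix, β* ∈ ℝ^p, and suppose Assumption H(A,3) holds with constant c > 0. Let v ∈ ℝ^q satisfy ‖A'(v − Aβ*)‖∞ ≤ κσ√(2n·log(p/η)), and let β̂ be a minimizer over ℝ^p of β ↦ ‖v − Aβ‖₂² + 2λ‖β‖₁. Then ‖A(β̂ − β*)‖₂² ≤ (72κ²σ²‖β*‖₀/c)·log(p/η). -/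
open Matrix Finset
open scoped Classical

/-- The `ℓ¹` norm increases by at least the off-support mass of a perturbation minus its
mass on the support. -/
theorem sum_abs_sub_sum_abs_le {ι : Type*} [Fintype ι] (b d : ι → ℝ) :
    ∑ j, |b j| - ∑ j, |b j + d j|
      ≤ ∑ j ∈ univ.filter (fun j => b j ≠ 0), |d j|
        - ∑ j ∈ univ.filter (fun j => b j = 0), |d j| := by
  rw [← sum_sub_distrib, sum_filter, sum_filter, ← sum_sub_distrib]
  refine sum_le_sum fun j _ => ?_
  by_cases hj : b j = 0
  · simp [hj]
  · have h := abs_sub_abs_le_abs_sub (b j) (b j + d j)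
    rw [sub_add_cancel_left, abs_neg] at h
    simpa [hj] using h

/-- The basic inequality for the LASSO, when the correlation of the residual with the design is
bounded by half of the tuning parameter. -/
theorem lasso_basic_inequality {m ι : Type*} [Fintype m] [Fintype ι]
    (A : Matrix m ι ℝ) (b d : ι → ℝ) (v : m → ℝ) (L : ℝ)
    (hv : ∀ i, |(Aᵀ *ᵥ (v - A *ᵥ b)) i| ≤ L)
    (hmin : (∑ i, (v i - (A *ᵥ (b + d)) i) ^ 2) + 4 * L * ∑ j, |b j + d j|
      ≤ (∑ i, (v i - (A *ᵥ b) i) ^ 2) + 4 * L * ∑ j, |b j|) :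
    ∑ i, (A *ᵥ d) i ^ 2 ≤ 2 * L * ∑ j, |d j| + 4 * L * (∑ j, |b j| - ∑ j, |b j + d j|) := by
  have hexpand : ∑ i, (v i - (A *ᵥ (b + d)) i) ^ 2
      = ∑ i, (v i - (A *ᵥ b) i) ^ 2 - 2 * ((v - A *ᵥ b) ⬝ᵥ (A *ᵥ d))
        + ∑ i, (A *ᵥ d) i ^ 2 := by
    simp only [mulVec_add, dotProduct, Pi.add_apply, Pi.sub_apply, mul_sum]
    rw [← sum_sub_distrib, ← sum_add_distrib]
    exact sum_congr rfl fun i _ => by ring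
  have hcorr : (v - A *ᵥ b) ⬝ᵥ (A *ᵥ d) ≤ L * ∑ j, |d j| := by
    rw [dotProduct_mulVec, ← mulVec_transpose, dotProduct, mul_sum]
    refine sum_le_sum fun j _ => (le_abs_self _).trans ?_
    rw [abs_mul]
    exact mul_le_mul_of_nonneg_right (hv j) (abs_nonneg _)
  linarith

/-- Sparsity inequality (prediction error) for the Transductive LASSO
(Theorem 2.2, first inequality). -/
theorem transductive_lasso_prediction_SI
    (p q n : ℕ) (hp : 1 ≤ p) (hq : 1 ≤ q) (hn : 1 ≤ n)
    (σ κ η : ℝ) (hσ : 0 < σ) (hκ : 0 < κ) (hη : 0 < η) (hη1 : η < 1)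
    (lam : ℝ) (hlam : lam = 2 * κ * σ * Real.sqrt (2 * n * Real.log (p / η)))
    (A : Matrix (Fin q) (Fin p) ℝ) (βs : Fin p → ℝ)
    (c : ℝ) (hc : 0 < c)
    -- Assumption H(A,3) with constant c
    (hH : ∀ α : Fin p → ℝ,
      (∑ j ∈ univ.filter (fun j => βs j = 0), |α j|)
        ≤ 3 * ∑ j ∈ univ.filter (fun j => βs j ≠ 0), |α j| →
      c * n * ∑ j ∈ univ.filter (fun j => βs j ≠ 0), (α j) ^ 2
        ≤ α ⬝ᵥ (Aᵀ * A).mulVec α)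
    (v : Fin q → ℝ)
    (hv : ∀ i, |(Aᵀ.mulVec (v - A.mulVec βs)) i|
            ≤ κ * σ * Real.sqrt (2 * n * Real.log (p / η)))
    (βh : Fin p → ℝ)
    (hmin : ∀ β : Fin p → ℝ,
      (∑ i, (v i - A.mulVec βh i) ^ 2) + 2 * lam * ∑ j, |βh j|
        ≤ (∑ i, (v i - A.mulVec β i) ^ 2) + 2 * lam * ∑ j, |β j|) :
    (∑ i, (A.mulVec (βh - βs) i) ^ 2)
      ≤ 72 * κ ^ 2 * σ ^ 2 * ((univ.filter (fun j => βs j ≠ 0)).card : ℝ) / c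
          * Real.log (p / η) := by
  set L : ℝ := κ * σ * Real.sqrt (2 * n * Real.log (p / η)) with hL
  have hp' : (1 : ℝ) ≤ p := by exact_mod_cast hp
  have hn' : (0 : ℝ) < n := by exact_mod_cast hn
  have hlog : 0 < Real.log (p / η) :=
    Real.log_pos ((one_lt_div hη).2 (hη1.trans_le hp'))
  have hLpos : 0 < L := by positivity
  have hLsq : L ^ 2 = κ ^ 2 * σ ^ 2 * (2 * n * Real.log (p / η)) := by
    rw [hL, mul_pow, mul_pow, Real.sq_sqrt (by positivity)]
  have hlamL : 2 * lam = 4 * L := by rw [hlam, hL]; ring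
  obtain ⟨d, rfl⟩ : ∃ d, βh = βs + d := ⟨βh - βs, by simp⟩
  rw [add_sub_cancel_left]
  have hbasic := lasso_basic_inequality A βs d v L hv (by simpa [hlamL] using hmin βs)
  have hsupp := sum_abs_sub_sum_abs_le βs d
  have hsplit := sum_filter_add_sum_filter_not univ (fun j => βs j = 0) (fun j => |d j|)
  have hquad : d ⬝ᵥ (Aᵀ * A) *ᵥ d = ∑ i, (A *ᵥ d) i ^ 2 := by
    rw [← mulVec_mulVec, dotProduct_mulVec, vecMul_transpose, dotProduct]
    exact sum_congr rfl fun i _ => (sq _).symm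
  have hcs := sq_sum_le_card_mul_sum_sq (s := univ.filter (fun j => βs j ≠ 0))
    (f := fun j => |d j|)
  simp only [sq_abs] at hcs
  have hEnn : 0 ≤ ∑ i, (A *ᵥ d) i ^ 2 := sum_nonneg fun i _ => sq_nonneg _
  have hH' := hH d
  rw [hquad] at hH'
  have hann : 0 ≤ ∑ j ∈ univ.filter (fun j => βs j ≠ 0), |d j| :=
    sum_nonneg fun i _ => abs_nonneg _
  have hbnn : 0 ≤ ∑ j ∈ univ.filter (fun j => βs j = 0), |d j| :=
    sum_nonneg fun i _ => abs_nonneg _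
  rw [← hsplit] at hbasic
  simp only [← ne_eq] at hbasic
  generalize (∑ i, (A *ᵥ d) i ^ 2) = E at *
  generalize (∑ j ∈ univ.filter (fun j => βs j ≠ 0), |d j|) = a at *
  generalize (∑ j ∈ univ.filter (fun j => βs j = 0), |d j|) = b at *
  generalize (∑ j ∈ univ.filter (fun j => βs j ≠ 0), d j ^ 2) = Q at *
  set s : ℝ := ((univ.filter (fun j => βs j ≠ 0)).card : ℝ)
  have hs : 0 ≤ s := Nat.cast_nonneg _
  have hE : E ≤ L * (6 * a - 2 * b) := by
    linarith [mul_le_mul_of_nonneg_left hsupp hLpos.le]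
  have hcone : b ≤ 3 * a := by
    linarith [nonneg_of_mul_nonneg_right (hEnn.trans hE) hLpos]
  have hEa : E ≤ 6 * L * a := by linarith [mul_nonneg hLpos.le hbnn]
  have hcn : 0 < c * n := mul_pos hc hn'
  have hrestr : c * n * a ^ 2 ≤ s * E := by
    linarith [mul_le_mul_of_nonneg_left hcs hcn.le,
      mul_le_mul_of_nonneg_left (hH' hcone) hs]
  have hEsq : E * (c * n * E) ≤ E * (36 * L ^ 2 * s) := by
    have h : E ^ 2 ≤ (6 * L * a) ^ 2 := pow_le_pow_left₀ hEnn hEa 2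
    linarith [mul_le_mul_of_nonneg_left h hcn.le,
      mul_le_mul_of_nonneg_left hrestr (by positivity : 0 ≤ 36 * L ^ 2)]
  rcases hEnn.eq_or_lt with h0 | hEpos
  · rw [← h0]
    positivity
  · have hfin : n * (c * E) ≤ n * (72 * κ ^ 2 * σ ^ 2 * s * Real.log (p / η)) := by
      have h := le_of_mul_le_mul_left hEsq hEpos
      rw [hLsq] at h
      linarith
    rw [div_mul_eq_mul_div, le_div_iff₀ hc, mul_comm]
    exact le_of_mul_le_mul_left hfin hn'
end

section
/- Let p, q, n ≥ 1 be integers, σ > 0, κ > 0, η ∈ (0,1), and set λ = 2κσ√(2n·log(p/η)). Let A be a q×p real matrix, β* ∈ ℝ^p, and suppose Assumption H(A,3) holds with constant c > 0. Let v ∈ ℝ^q satisfy ‖A'(v − Aβ*)‖∞ ≤ κσ√(2n·log(p/η)), and let β̂ be a minimizer over ℝ^p of β ↦ ‖v − Aβ‖₂² + 2λ‖β‖₁. Then ‖β̂ − β*‖₁ ≤ (24√2·κσ‖β*‖₀/c)·√(log(p/η)/n). -/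
open Matrix Finset
open scoped Classical

/-- Hölder's inequality for the pairing of the sup norm and the `ℓ¹` norm. -/
lemma dotProduct_le_mul_sum_abs {ι : Type*} [Fintype ι] {w : ι → ℝ} {r : ℝ}
    (hw : ∀ i, |w i| ≤ r) (α : ι → ℝ) : w ⬝ᵥ α ≤ r * ∑ i, |α i| := by
  rw [dotProduct, mul_sum]
  refine sum_le_sum fun i _ => (le_abs_self _).trans ?_
  rw [abs_mul]
  exact mul_le_mul_of_nonneg_right (hw i) (abs_nonneg _)

/-- Splitting of an `ℓ¹` difference along the support of the reference vector. -/
lemma sum_abs_sub_sum_abs_le_support {ι : Type*} [Fintype ι] (x y : ι → ℝ) :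
    (∑ j, |x j|) - ∑ j, |y j| ≤
      (∑ j ∈ univ.filter (fun j => x j ≠ 0), |y j - x j|)
        - ∑ j ∈ univ.filter (fun j => x j = 0), |y j - x j| := by
  rw [← sum_sub_distrib, sum_filter, sum_filter, ← sum_sub_distrib]
  refine sum_le_sum fun j _ => ?_
  by_cases h : x j = 0
  · simp [h]
  · have := abs_sub_abs_le_abs_sub (x j) (y j)
    rw [abs_sub_comm] at this
    simpa [h] using this

/-- The basic inequality for the LASSO with tuning parameter `2 * r`, where `r` bounds the
correlations between the columns of `A` and the residual at `x`. -/
lemma lasso_basic_inequality_s4 {ι κ : Type*} [Fintype ι] [Fintype κ]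
    (A : Matrix κ ι ℝ) (v : κ → ℝ) (x y : ι → ℝ) {r : ℝ} (hr : 0 ≤ r)
    (hv : ∀ i, |(Aᵀ *ᵥ (v - A *ᵥ x)) i| ≤ r)
    (hle : (∑ i, (v i - (A *ᵥ y) i) ^ 2) + 2 * (2 * r) * ∑ j, |y j|
      ≤ (∑ i, (v i - (A *ᵥ x) i) ^ 2) + 2 * (2 * r) * ∑ j, |x j|) :
    (y - x) ⬝ᵥ (Aᵀ * A) *ᵥ (y - x) ≤
      6 * r * (∑ j ∈ univ.filter (fun j => x j ≠ 0), |y j - x j|)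
        - 2 * r * ∑ j ∈ univ.filter (fun j => x j = 0), |y j - x j| := by
  have hholder := dotProduct_le_mul_sum_abs hv (y - x)
  have hquad : (y - x) ⬝ᵥ (Aᵀ * A) *ᵥ (y - x) = ∑ i, ((A *ᵥ y) i - (A *ᵥ x) i) ^ 2 := by
    rw [← mulVec_mulVec, dotProduct_mulVec, vecMul_transpose, mulVec_sub]
    simp [dotProduct, sq]
  have hcross : (Aᵀ *ᵥ (v - A *ᵥ x)) ⬝ᵥ (y - x) =
      ∑ i, (v i - (A *ᵥ x) i) * ((A *ᵥ y) i - (A *ᵥ x) i) := by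
    rw [mulVec_transpose, ← dotProduct_mulVec, mulVec_sub]
    simp [dotProduct]
  have hexpand : ∑ i, (v i - (A *ᵥ y) i) ^ 2 = (∑ i, (v i - (A *ᵥ x) i) ^ 2)
      - 2 * (∑ i, (v i - (A *ᵥ x) i) * ((A *ᵥ y) i - (A *ᵥ x) i))
      + ∑ i, ((A *ᵥ y) i - (A *ᵥ x) i) ^ 2 := by
    rw [mul_sum, ← sum_sub_distrib, ← sum_add_distrib]
    exact sum_congr rfl fun i _ => by ring
  have hsplit : ∑ j, |(y - x) j| = (∑ j ∈ univ.filter (fun j => x j = 0), |y j - x j|)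
      + ∑ j ∈ univ.filter (fun j => x j ≠ 0), |y j - x j| := by
    simpa using (sum_filter_add_sum_filter_not univ (fun j => x j = 0)
      (fun j => |y j - x j|)).symm
  have hsupp := mul_le_mul_of_nonneg_left (sum_abs_sub_sum_abs_le_support x y) hr
  rw [hsplit, hcross] at hholder
  rw [hquad]
  linarith

/-- Sparsity inequality (ℓ₁ estimation error) for the Transductive LASSO
(Theorem 2.2, second inequality). -/
theorem transductive_lasso_l1_SI
    (p q n : ℕ) (hp : 1 ≤ p) (hq : 1 ≤ q) (hn : 1 ≤ n)
    (σ κ η : ℝ) (hσ : 0 < σ) (hκ : 0 < κ) (hη : 0 < η) (hη1 : η < 1)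
    (lam : ℝ) (hlam : lam = 2 * κ * σ * Real.sqrt (2 * n * Real.log (p / η)))
    (A : Matrix (Fin q) (Fin p) ℝ) (βs : Fin p → ℝ)
    (c : ℝ) (hc : 0 < c)
    -- Assumption H(A,3) with constant c
    (hH : ∀ α : Fin p → ℝ,
      (∑ j ∈ univ.filter (fun j => βs j = 0), |α j|)
        ≤ 3 * ∑ j ∈ univ.filter (fun j => βs j ≠ 0), |α j| →
      c * n * ∑ j ∈ univ.filter (fun j => βs j ≠ 0), (α j) ^ 2
        ≤ α ⬝ᵥ (Aᵀ * A).mulVec α)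
    (v : Fin q → ℝ)
    (hv : ∀ i, |(Aᵀ.mulVec (v - A.mulVec βs)) i|
            ≤ κ * σ * Real.sqrt (2 * n * Real.log (p / η)))
    (βh : Fin p → ℝ)
    (hmin : ∀ β : Fin p → ℝ,
      (∑ i, (v i - A.mulVec βh i) ^ 2) + 2 * lam * ∑ j, |βh j|
        ≤ (∑ i, (v i - A.mulVec β i) ^ 2) + 2 * lam * ∑ j, |β j|) :
    (∑ j, |βh j - βs j|)
      ≤ 24 * Real.sqrt 2 * κ * σ * ((univ.filter (fun j => βs j ≠ 0)).card : ℝ) / c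
          * Real.sqrt (Real.log (p / η) / n) := by
  have hn0 : (0 : ℝ) < n := by exact_mod_cast hn
  have hp1 : (1 : ℝ) ≤ p := by exact_mod_cast hp
  have hL : 0 < Real.log (p / η) :=
    Real.log_pos ((one_lt_div hη).2 (hη1.trans_le hp1))
  have hsqrt : Real.sqrt (2 * n * Real.log (p / η))
      = Real.sqrt 2 * n * Real.sqrt (Real.log (p / η) / n) := by
    rw [show 2 * (n : ℝ) * Real.log (p / η) = 2 * ((n : ℝ) ^ 2 * (Real.log (p / η) / n)) by
      field_simp, Real.sqrt_mul zero_le_two, Real.sqrt_mul (sq_nonneg _), Real.sqrt_sq hn0.le,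
      mul_assoc]
  set r := κ * σ * Real.sqrt (2 * n * Real.log (p / η)) with hr_def
  have hr : 0 < r := by positivity
  have hbasic := lasso_basic_inequality_s4 A v βs βh hr.le hv (by
    have h := hmin βs
    rwa [show lam = 2 * r by rw [hlam, hr_def]; ring] at h)
  have hRE := hH (βh - βs)
  simp only [Pi.sub_apply] at hRE
  have hsplit := sum_filter_add_sum_filter_not univ (fun j => βs j = 0)
    (fun j => |βh j - βs j|)
  have hCS := sq_sum_le_card_mul_sum_sq (s := univ.filter (fun j => βs j ≠ 0))
    (f := fun j => |βh j - βs j|)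
  simp only [sq_abs] at hCS
  have hquad : 0 ≤ (βh - βs) ⬝ᵥ (Aᵀ * A) *ᵥ (βh - βs) := by
    rw [← mulVec_mulVec, dotProduct_mulVec, vecMul_transpose]
    exact sum_nonneg fun i _ => mul_self_nonneg _
  have ha : 0 ≤ ∑ j ∈ univ.filter (fun j => βs j ≠ 0), |βh j - βs j| :=
    sum_nonneg fun _ _ => abs_nonneg _
  have hb : 0 ≤ ∑ j ∈ univ.filter (fun j => βs j = 0), |βh j - βs j| :=
    sum_nonneg fun _ _ => abs_nonneg _
  rw [← hsplit]
  set a := ∑ j ∈ univ.filter (fun j => βs j ≠ 0), |βh j - βs j|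
  set b := ∑ j ∈ univ.filter (fun j => βs j = 0), |βh j - βs j|
  set s := ((univ.filter (fun j => βs j ≠ 0)).card : ℝ)
  have hs : 0 ≤ s := Nat.cast_nonneg _
  have hcone : b ≤ 3 * a := by
    refine le_of_mul_le_mul_left ?_ hr
    linarith
  have hcn : 0 < c * n := mul_pos hc hn0
  have henergy := (hRE hcone).trans (hbasic.trans (sub_le_self _ (by positivity)))
  have hbound : a ≤ 6 * r * s / (c * n) := by
    rw [le_div_iff₀ hcn]
    rcases ha.eq_or_lt with h | h
    · rw [← h, zero_mul]
      exact mul_nonneg (mul_nonneg (by norm_num) hr.le) hs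
    · refine le_of_mul_le_mul_left ?_ h
      have h₁ := mul_le_mul_of_nonneg_left hCS hcn.le
      have h₂ := mul_le_mul_of_nonneg_left henergy hs
      linarith
  calc b + a ≤ 4 * (6 * r * s / (c * n)) := by linarith
    _ = _ := by
      rw [hr_def, hsqrt]
      field_simp
      ring
end

section
/- Let A be a q×p real matrix, v ∈ ℝ^q, λ > 0, and β̃, β* ∈ ℝ^p. Then ‖A(β̃ − β*)‖₂² ≤ ‖β̃ − β*‖₁ · ( ‖A'(Aβ̃ − v)‖∞ + ‖A'(v − Aβ*)‖∞ ). In particular, if ‖A'(v − Aβ̃)‖∞ ≤ λ and ‖A'(v − Aβ*)‖∞ ≤ λ, then ‖A(β̃ − β*)‖₂² ≤ 2λ·‖β̃ − β*‖₁. -/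
open Matrix

/-- The sup-norm of a finite real vector, `‖v‖∞ = max_i |v_i|`. -/
noncomputable def supNorm {d : ℕ} (v : Fin d → ℝ) : ℝ := ⨆ i, |v i|

theorem abs_le_supNorm {d : ℕ} (v : Fin d → ℝ) (i : Fin d) : |v i| ≤ supNorm v :=
  le_ciSup (f := fun i => |v i|) (Set.finite_range _).bddAbove i

theorem supNorm_neg {d : ℕ} (v : Fin d → ℝ) : supNorm (-v) = supNorm v := by
  simp [supNorm]

/-- Hölder's inequality for the pairing of `ℓ¹` and `ℓ^∞`. -/
theorem dotProduct_le_sum_abs_mul_supNorm {d : ℕ} (u w : Fin d → ℝ) :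
    u ⬝ᵥ w ≤ (∑ j, |u j|) * supNorm w := by
  rw [dotProduct, Finset.sum_mul]
  refine Finset.sum_le_sum fun j _ => ?_
  calc u j * w j ≤ |u j| * |w j| := (le_abs_self _).trans_eq (abs_mul _ _)
    _ ≤ |u j| * supNorm w := by gcongr; exact abs_le_supNorm w j

theorem sum_sq_mulVec_sub {q p : ℕ} (A : Matrix (Fin q) (Fin p) ℝ) (v : Fin q → ℝ)
    (b c : Fin p → ℝ) :
    ∑ i, (A.mulVec (b - c) i) ^ 2 =
      (b - c) ⬝ᵥ Aᵀ.mulVec (A.mulVec b - v) + (b - c) ⬝ᵥ Aᵀ.mulVec (v - A.mulVec c) := by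
  rw [← dotProduct_add, ← mulVec_add, sub_add_sub_cancel, ← mulVec_sub, dotProduct_mulVec,
    vecMul_transpose]
  simp only [dotProduct, sq]

/-- Hölder-type basic inequality for the Transductive Dantzig Selector:
`‖A(β̃ − β*)‖₂² ≤ ‖β̃ − β*‖₁·(‖A'(Aβ̃ − v)‖∞ + ‖A'(v − Aβ*)‖∞)`, and in particular,
if both sup-norms are at most `λ`, then `‖A(β̃ − β*)‖₂² ≤ 2λ·‖β̃ − β*‖₁`. -/
theorem dantzig_basic_inequality
    (q p : ℕ)
    (A : Matrix (Fin q) (Fin p) ℝ) (v : Fin q → ℝ)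
    (lam : ℝ) (hlam : 0 < lam)
    (βt βs : Fin p → ℝ) :
    ((∑ i, (A.mulVec (βt - βs) i) ^ 2)
        ≤ (∑ j, |βt j - βs j|)
            * (supNorm (Aᵀ.mulVec (A.mulVec βt - v))
                + supNorm (Aᵀ.mulVec (v - A.mulVec βs)))) ∧
      (supNorm (Aᵀ.mulVec (v - A.mulVec βt)) ≤ lam →
        supNorm (Aᵀ.mulVec (v - A.mulVec βs)) ≤ lam →
        (∑ i, (A.mulVec (βt - βs) i) ^ 2)
          ≤ 2 * lam * ∑ j, |βt j - βs j|) := by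
  have basic : (∑ i, (A.mulVec (βt - βs) i) ^ 2)
      ≤ (∑ j, |βt j - βs j|)
          * (supNorm (Aᵀ.mulVec (A.mulVec βt - v))
              + supNorm (Aᵀ.mulVec (v - A.mulVec βs))) := by
    rw [sum_sq_mulVec_sub A v, mul_add]
    exact add_le_add (dotProduct_le_sum_abs_mul_supNorm _ _)
      (dotProduct_le_sum_abs_mul_supNorm _ _)
  refine ⟨basic, fun ht hs => basic.trans ?_⟩
  rw [← neg_sub v, mulVec_neg, supNorm_neg, mul_comm, two_mul]
  gcongr
end

section
/- Let A be a q×p real matrix, v ∈ ℝ^q, λ > 0, β* ∈ ℝ^p, and assume ‖A'(Aβ* − v)‖∞ ≤ λ/2. Let β̂ be a minimizer over ℝ^p of β ↦ ‖v − Aβ‖₂² + 2λ‖β‖₁. Then ‖A(β̂ − β*)‖₂² + λ‖β̂ − β*‖₁ ≤ 4λ·Σ_{j : β*_j ≠ 0} |β*_j − β̂_j|. -/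
open Matrix Finset
open scoped Classical

/-- Key intermediate inequality in the proof of Theorem 2.2: under the
confidence-region condition `‖A'(Aβ* − v)‖∞ ≤ λ/2`, the Transductive LASSO satisfies
`‖A(β̂ − β*)‖₂² + λ‖β̂ − β*‖₁ ≤ 4λ·Σ_{j : β*_j ≠ 0}|β*_j − β̂_j|`. -/
theorem lasso_support_inequality
    (q p : ℕ)
    (A : Matrix (Fin q) (Fin p) ℝ) (v : Fin q → ℝ)
    (lam : ℝ) (hlam : 0 < lam)
    (βs : Fin p → ℝ)
    (hconf : ∀ i, |(Aᵀ.mulVec (A.mulVec βs - v)) i| ≤ lam / 2)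
    (βh : Fin p → ℝ)
    (hmin : ∀ β : Fin p → ℝ,
      (∑ i, (v i - A.mulVec βh i) ^ 2) + 2 * lam * ∑ j, |βh j|
        ≤ (∑ i, (v i - A.mulVec β i) ^ 2) + 2 * lam * ∑ j, |β j|) :
    (∑ i, (A.mulVec (βh - βs) i) ^ 2) + lam * ∑ j, |βh j - βs j|
      ≤ 4 * lam * ∑ j ∈ univ.filter (fun j => βs j ≠ 0), |βs j - βh j| := by
  have hadj : ∑ i, (A.mulVec βs - v) i * A.mulVec (βh - βs) i
      = ∑ j, Aᵀ.mulVec (A.mulVec βs - v) j * (βh - βs) j := by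
    have h := dotProduct_mulVec (A.mulVec βs - v) A (βh - βs)
    rwa [← mulVec_transpose] at h
  have hexpand : ∑ i, (v i - A.mulVec βh i) ^ 2
      = ∑ i, (v i - A.mulVec βs i) ^ 2
        + 2 * ∑ i, (A.mulVec βs - v) i * A.mulVec (βh - βs) i
        + ∑ i, (A.mulVec (βh - βs) i) ^ 2 := by
    rw [mul_sum, ← sum_add_distrib, ← sum_add_distrib]
    refine sum_congr rfl fun i _ => ?_
    simp only [mulVec_sub, Pi.sub_apply]
    ring
  have hcross : -(lam / 2 * ∑ j, |βh j - βs j|)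
      ≤ ∑ j, Aᵀ.mulVec (A.mulVec βs - v) j * (βh - βs) j := by
    rw [mul_sum, ← sum_neg_distrib]
    refine sum_le_sum fun j _ => ?_
    have h := mul_le_mul_of_nonneg_right (hconf j) (abs_nonneg (βh j - βs j))
    rw [← abs_mul] at h
    exact (abs_le.mp h).1
  have hsupp : ∑ j, |βh j - βs j| + ∑ j, |βs j| - ∑ j, |βh j|
      ≤ 2 * ∑ j ∈ univ.filter (fun j => βs j ≠ 0), |βs j - βh j| := by
    rw [sum_filter, mul_sum, ← sum_add_distrib, ← sum_sub_distrib]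
    refine sum_le_sum fun j _ => ?_
    by_cases hj : βs j = 0
    · simp [hj]
    · rw [if_pos hj, abs_sub_comm (βh j)]
      linarith [abs_sub_abs_le_abs_sub (βs j) (βh j)]
  have hscaled := mul_le_mul_of_nonneg_left hsupp hlam.le
  linarith [hmin βs]
end

section
/- Let A be a q×p real matrix, v ∈ ℝ^q, λ > 0, β* ∈ ℝ^p, and assume ‖A'(Aβ* − v)‖∞ ≤ λ/2. Let β̂ be a minimizer over ℝ^p of β ↦ ‖v − Aβ‖₂² + 2λ‖β‖₁. Then Σ_{j : β*_j = 0} |β̂_j − β*_j| ≤ 3·Σ_{j : β*_j ≠ 0} |β̂_j − β*_j|; that is, the error vector β̂ − β* belongs to the cone {α ∈ ℝ^p : Σ_{j:β*_j=0}|α_j| ≤ 3·Σ_{j:β*_j≠0}|α_j|}. -/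
open Matrix Finset
open scoped Classical

/-- The residual sum of squares lies above its linearization. -/
theorem residual_sq_ge_linearization {m n : Type*} [Fintype m] [Fintype n]
    (A : Matrix m n ℝ) (v : m → ℝ) (x y : n → ℝ) :
    (∑ i, (v i - A.mulVec x i) ^ 2) + 2 * ∑ j, (Aᵀ.mulVec (A.mulVec x - v)) j * (y j - x j)
      ≤ ∑ i, (v i - A.mulVec y i) ^ 2 := by
  have hadj : ∑ j, (Aᵀ.mulVec (A.mulVec x - v)) j * (y j - x j)
      = ∑ i, (A.mulVec x i - v i) * (A.mulVec y i - A.mulVec x i) := by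
    change Aᵀ.mulVec (A.mulVec x - v) ⬝ᵥ (y - x)
      = (A.mulVec x - v) ⬝ᵥ (A.mulVec y - A.mulVec x)
    rw [Matrix.mulVec_transpose, ← Matrix.mulVec_sub, Matrix.dotProduct_mulVec]
  rw [hadj, Finset.mul_sum, ← Finset.sum_add_distrib]
  refine Finset.sum_le_sum fun i _ => ?_
  nlinarith [sq_nonneg (A.mulVec y i - A.mulVec x i)]

/-- Cone condition with parameter 3 for the Transductive LASSO error: under the
confidence-region condition `‖A'(Aβ* − v)‖∞ ≤ λ/2`, the error `β̂ − β*` satisfies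
`Σ_{j : β*_j = 0}|β̂_j − β*_j| ≤ 3·Σ_{j : β*_j ≠ 0}|β̂_j − β*_j|`. -/
theorem lasso_cone_condition
    (q p : ℕ)
    (A : Matrix (Fin q) (Fin p) ℝ) (v : Fin q → ℝ)
    (lam : ℝ) (hlam : 0 < lam)
    (βs : Fin p → ℝ)
    (hconf : ∀ i, |(Aᵀ.mulVec (A.mulVec βs - v)) i| ≤ lam / 2)
    (βh : Fin p → ℝ)
    (hmin : ∀ β : Fin p → ℝ,
      (∑ i, (v i - A.mulVec βh i) ^ 2) + 2 * lam * ∑ j, |βh j|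
        ≤ (∑ i, (v i - A.mulVec β i) ^ 2) + 2 * lam * ∑ j, |β j|) :
    (∑ j ∈ univ.filter (fun j => βs j = 0), |βh j - βs j|)
      ≤ 3 * ∑ j ∈ univ.filter (fun j => βs j ≠ 0), |βh j - βs j| := by
  have hlin := residual_sq_ge_linearization A v βs βh
  have hdual : -(lam / 2 * ∑ j, |βh j - βs j|)
      ≤ ∑ j, (Aᵀ.mulVec (A.mulVec βs - v)) j * (βh j - βs j) := by
    rw [Finset.mul_sum, ← Finset.sum_neg_distrib]
    refine Finset.sum_le_sum fun j _ => ?_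
    refine (neg_le_neg ?_).trans (neg_abs_le _)
    rw [abs_mul]
    exact mul_le_mul_of_nonneg_right (hconf j) (abs_nonneg _)
  have hl1 : 2 * ∑ j, |βh j| ≤ 2 * ∑ j, |βs j| + ∑ j, |βh j - βs j| := by
    refine le_of_mul_le_mul_left ?_ hlam
    linarith [hmin βs]
  have hoff : ∑ j ∈ univ.filter (fun j => βs j = 0), |βh j - βs j|
      = ∑ j ∈ univ.filter (fun j => βs j = 0), (|βh j| - |βs j|) := by
    refine Finset.sum_congr rfl fun j hj => ?_
    simp [(Finset.mem_filter.mp hj).2]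
  have hon : -∑ j ∈ univ.filter (fun j => βs j ≠ 0), |βh j - βs j|
      ≤ ∑ j ∈ univ.filter (fun j => βs j ≠ 0), (|βh j| - |βs j|) := by
    rw [← Finset.sum_neg_distrib]
    refine Finset.sum_le_sum fun j _ => ?_
    linarith [abs_sub_abs_le_abs_sub (βs j) (βh j), abs_sub_comm (βs j) (βh j)]
  have hsplit := Finset.sum_filter_add_sum_filter_not univ (fun j => βs j = 0)
    (fun j => |βh j - βs j|)
  have hsplit_l1 := Finset.sum_filter_add_sum_filter_not univ (fun j => βs j = 0)
    (fun j => |βh j| - |βs j|)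
  rw [Finset.sum_sub_distrib (s := univ)] at hsplit_l1
  linarith
end

section
/- Let p, n ≥ 1 be integers, σ > 0, κ > 0, η ∈ (0,1), and set λ = κσ√(2n·log(p/η)). Let β* ∈ ℝ^p, let v ∈ ℝ^p satisfy ‖√n·(v − √n·β*)‖∞ ≤ λ, and let β̃ be a minimizer of ‖β‖₁ over {β ∈ ℝ^p : ‖√n·(v − √n·β)‖∞ ≤ λ}. Then ‖β̃ − β*‖₂² ≤ (8κ²σ²‖β*‖₀/n)·log(p/η). -/
open Finset
open scoped Classical

/-- A minimizer of the `ℓ¹` norm under coordinatewise constraints vanishes at every coordinate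
where zero is admissible. -/
theorem eq_zero_of_minimal_sum_abs {ι : Type*} [Fintype ι] (C : ι → ℝ → Prop) {x : ι → ℝ}
    (hx : ∀ i, C i (x i))
    (hmin : ∀ y : ι → ℝ, (∀ i, C i (y i)) → ∑ i, |x i| ≤ ∑ i, |y i|)
    {j : ι} (hj : C j 0) : x j = 0 := by
  have hle := hmin (Function.update x j 0) fun i => by
    by_cases hij : i = j
    · subst hij
      simpa using hj
    · simpa [hij] using hx i
  have hrest : ∑ i ∈ univ.erase j, |Function.update x j 0 i| = ∑ i ∈ univ.erase j, |x i| :=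
    sum_congr rfl fun i hi => by rw [Function.update_of_ne (ne_of_mem_erase hi)]
  rw [← add_sum_erase _ _ (mem_univ j),
    ← add_sum_erase _ (fun i => |Function.update x j 0 i|) (mem_univ j), hrest] at hle
  simpa using hle

/-- Estimation objective: sparsity inequality for the Transductive Dantzig Selector
with `A = √n·I_p` (the restricted eigenvalue condition holds automatically with c = 1). -/
theorem transductive_dantzig_identity_SI
    (p n : ℕ) (hp : 1 ≤ p) (hn : 1 ≤ n)
    (σ κ η : ℝ) (hσ : 0 < σ) (hκ : 0 < κ) (hη : 0 < η) (hη1 : η < 1)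
    (lam : ℝ) (hlam : lam = κ * σ * Real.sqrt (2 * n * Real.log (p / η)))
    (βs : Fin p → ℝ)
    (v : Fin p → ℝ)
    (hv : ∀ j, |Real.sqrt n * (v j - Real.sqrt n * βs j)| ≤ lam)
    (βt : Fin p → ℝ)
    (hfeas : ∀ j, |Real.sqrt n * (v j - Real.sqrt n * βt j)| ≤ lam)
    (hmin : ∀ β : Fin p → ℝ,
      (∀ j, |Real.sqrt n * (v j - Real.sqrt n * β j)| ≤ lam) →
      (∑ j, |βt j|) ≤ ∑ j, |β j|) :
    (∑ j, (βt j - βs j) ^ 2)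
      ≤ 8 * κ ^ 2 * σ ^ 2 * ((univ.filter (fun j => βs j ≠ 0)).card : ℝ) / n
          * Real.log (p / η) := by
  have hn0 : (0 : ℝ) < n := by exact_mod_cast hn
  have hlog : 0 ≤ Real.log (p / η) := by
    apply Real.log_nonneg
    rw [le_div_iff₀ hη]
    have : (1 : ℝ) ≤ p := by exact_mod_cast hp
    linarith
  have hlam_sq : lam ^ 2 = κ ^ 2 * σ ^ 2 * (2 * n * Real.log (p / η)) := by
    rw [hlam, mul_pow, Real.sq_sqrt (by positivity)]
    ring
  have hoff : ∀ j, βs j = 0 → βt j = 0 := fun j hj =>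
    eq_zero_of_minimal_sum_abs (fun i x => |√n * (v i - √n * x)| ≤ lam) hfeas hmin
      (by simpa [hj] using hv j)
  have hsq : ∀ j, (βt j - βs j) ^ 2 ≤ 8 * κ ^ 2 * σ ^ 2 / n * Real.log (p / η) := by
    intro j
    have hdiff : √n * (v j - √n * βs j) - √n * (v j - √n * βt j) = n * (βt j - βs j) := by
      linear_combination (βt j - βs j) * Real.mul_self_sqrt hn0.le
    have habs : |n * (βt j - βs j)| ≤ 2 * lam := by
      rw [← hdiff]
      linarith [abs_sub (√n * (v j - √n * βs j)) (√n * (v j - √n * βt j)), hv j, hfeas j]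
    have hscaled : n ^ 2 * (βt j - βs j) ^ 2 ≤ 4 * lam ^ 2 := by
      have := pow_le_pow_left₀ (abs_nonneg _) habs 2
      rw [sq_abs] at this
      linarith
    rw [hlam_sq] at hscaled
    refine le_of_mul_le_mul_left (hscaled.trans_eq ?_) (pow_pos hn0 2)
    field_simp
    ring
  calc ∑ j, (βt j - βs j) ^ 2
      = ∑ j ∈ univ.filter (fun j => βs j ≠ 0), (βt j - βs j) ^ 2 := by
        symm
        apply sum_filter_of_ne
        intro j _ hj hzero
        exact hj (by simp [hzero, hoff j hzero])
    _ ≤ (univ.filter (fun j => βs j ≠ 0)).card •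
          (8 * κ ^ 2 * σ ^ 2 / n * Real.log (p / η)) := sum_le_card_nsmul _ _ _ fun j _ => hsq j
    _ = _ := by
        rw [nsmul_eq_mul]
        ring
end
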